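/- Let R and S be real n×n matrices such that I − RᵀR is positive definite and I − SᵀS − (RᵀS)ᵀ(I − RᵀR)⁻¹(RᵀS) is positive semidefinite. Then for all vectors a, b, g ∈ ℝⁿ, 2 bᵀ(R a + S g) ≤ ‖a‖² + ‖b‖² + ‖g‖². -/

import Mathlib

open Matrix

/-- Euclidean norm of a vector in `ℝⁿ`. -/
noncomputable def eNorm {n : ℕ} (v : Fin n → ℝ) : ℝ :=
  ‖(EuclideanSpace.equiv (Fin n) ℝ).symm v‖

lemma eNorm_sq {n : ℕ} (v : Fin n → ℝ) : eNorm v ^ 2 = v ⬝ᵥ v := by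
  rw [eNorm, EuclideanSpace.real_norm_sq_eq]
  simp [dotProduct, sq]

/-- Nonnegativity of the Schur complement makes `[R S]` a contraction. -/
lemma dotProduct_mulVec_add_mulVec_self_le {m n l : Type*} [Fintype m] [Fintype n] [Fintype l]
    [DecidableEq m] [DecidableEq n] {R : Matrix l m ℝ} {S : Matrix l n ℝ}
    (hR : (1 - Rᵀ * R).PosDef)
    (hS : (1 - Sᵀ * S - (Rᵀ * S)ᵀ * (1 - Rᵀ * R)⁻¹ * (Rᵀ * S)).PosSemidef)
    (a : m → ℝ) (g : n → ℝ) :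
    (R *ᵥ a + S *ᵥ g) ⬝ᵥ (R *ᵥ a + S *ᵥ g) ≤ a ⬝ᵥ a + g ⬝ᵥ g := by
  let _ : Invertible (1 - Rᵀ * R) := hR.isUnit.invertible
  have hblock : (fromBlocks (1 - Rᵀ * R) (-(Rᵀ * S)) (-(Rᵀ * S))ᴴ (1 - Sᵀ * S)).PosSemidef := by
    rw [hR.fromBlocks₁₁]
    simpa [conjTranspose_eq_transpose_of_trivial] using hS
  have hnonneg := hblock.dotProduct_mulVec_nonneg (Sum.elim a g)
  have hRR : a ⬝ᵥ (Rᵀ *ᵥ R *ᵥ a) = R *ᵥ a ⬝ᵥ R *ᵥ a := by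
    rw [dotProduct_mulVec, vecMul_transpose]
  have hRS : a ⬝ᵥ (Rᵀ *ᵥ S *ᵥ g) = R *ᵥ a ⬝ᵥ S *ᵥ g := by
    rw [dotProduct_mulVec, vecMul_transpose]
  have hSR : g ⬝ᵥ (Sᵀ *ᵥ R *ᵥ a) = R *ᵥ a ⬝ᵥ S *ᵥ g := by
    rw [dotProduct_mulVec, vecMul_transpose, dotProduct_comm]
  have hSS : g ⬝ᵥ (Sᵀ *ᵥ S *ᵥ g) = S *ᵥ g ⬝ᵥ S *ᵥ g := by
    rw [dotProduct_mulVec, vecMul_transpose]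
  simp only [star_trivial, fromBlocks_mulVec, Sum.elim_comp_inl, Sum.elim_comp_inr,
    sumElim_dotProduct_sumElim, conjTranspose_eq_transpose_of_trivial, transpose_neg,
    transpose_mul, transpose_transpose, sub_mulVec, neg_mulVec, one_mulVec, ← mulVec_mulVec,
    dotProduct_add, dotProduct_sub, dotProduct_neg, hRR, hRS, hSR, hSS] at hnonneg
  rw [add_dotProduct, dotProduct_add, dotProduct_add, dotProduct_comm (S *ᵥ g) (R *ᵥ a)]
  linarith

lemma two_mul_dotProduct_le {m : Type*} [Fintype m] (v w : m → ℝ) :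
    2 * (v ⬝ᵥ w) ≤ v ⬝ᵥ v + w ⬝ᵥ w := by
  have h : 0 ≤ (v - w) ⬝ᵥ (v - w) := Finset.sum_nonneg fun i _ => mul_self_nonneg _
  rw [sub_dotProduct, dotProduct_sub, dotProduct_sub, dotProduct_comm w v] at h
  linarith

/-- under the conditions on `R` and `S`,
`2 bᵀ(Ra + Sg) ≤ ‖a‖² + ‖b‖² + ‖g‖²`. -/
theorem weak_inhomogeneous_cross_term_bound (n : ℕ) (hn : 0 < n)
    (R S : Matrix (Fin n) (Fin n) ℝ)
    (hR : (1 - Rᵀ * R).PosDef)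
    (hS : (1 - Sᵀ * S - (Rᵀ * S)ᵀ * (1 - Rᵀ * R)⁻¹ * (Rᵀ * S)).PosSemidef)
    (a b g : Fin n → ℝ) :
    2 * (b ⬝ᵥ (R.mulVec a + S.mulVec g)) ≤ eNorm a ^ 2 + eNorm b ^ 2 + eNorm g ^ 2 := by
  rw [eNorm_sq, eNorm_sq, eNorm_sq]
  linarith [two_mul_dotProduct_le b (R *ᵥ a + S *ᵥ g),
    dotProduct_mulVec_add_mulVec_self_le hR hS a g]
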